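/- arXiv:2503.02283 — 2 statements merged into one kernel-verified Lean document; each statement's English description precedes it below -/
import Mathlib

section
/- Let G₁ and G₂ be independent standard Gaussian random variables, and let u, v, u', v' ≥ 0 and σx, σy be real numbers. Then E[(cos(√(2u)·σx·G₁ + √(2v)·σy·G₂) − e^{−uσx²−vσy²})·(cos(√(2u')·σx·G₁ + √(2v')·σy·G₂) − e^{−u'σx²−v'σy²})] = (1/2)·exp(−(√u+√u')²σx² − (√v+√v')²σy²) + (1/2)·exp(−(√u−√u')²σx² − (√v−√v')²σy²) − exp(−(u+u')σx² − (v+v')σy²). -/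
open MeasureTheory ProbabilityTheory

/-- The cosine of a linear combination of independent standard Gaussians has expectation
`exp (-(a ^ 2 + b ^ 2) / 2)`. -/
theorem integral_cos_linear_of_indepFun_gaussianReal
    {Ω : Type*} [MeasurableSpace Ω] {μ : Measure Ω} [IsProbabilityMeasure μ]
    {X Y : Ω → ℝ} (hX : Measurable X) (hY : Measurable Y)
    (hXlaw : μ.map X = gaussianReal 0 1) (hYlaw : μ.map Y = gaussianReal 0 1)
    (hind : IndepFun X Y μ) (a b : ℝ) :
    ∫ ω, Real.cos (a * X ω + b * Y ω) ∂μ = Real.exp (-(a ^ 2 + b ^ 2) / 2) := by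
  have haX := gaussianReal_const_mul ⟨hX.aemeasurable, hXlaw⟩ a
  have hbY := gaussianReal_const_mul ⟨hY.aemeasurable, hYlaw⟩ b
  have hsum := gaussianReal_add_gaussianReal_of_indepFun
    (hind.comp (measurable_const_mul a) (measurable_const_mul b)) haX.map_eq hbY.map_eq
  have hmeas : Measurable fun ω => a * X ω + b * Y ω := by fun_prop
  have hchar := congrArg (fun ν : Measure ℝ => (charFun ν 1).re) hsum
  beta_reduce at hchar
  rw [charFun_gaussianReal, charFun_apply_real] at hchar
  have hint : Integrable (fun ω => Complex.exp (((a * X ω + b * Y ω : ℝ) : ℂ) * Complex.I)) μ :=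
    Integrable.of_bound (by fun_prop) 1
      (ae_of_all _ fun ω => (Complex.norm_exp_ofReal_mul_I _).le)
  have hre : (∫ ω, Complex.exp (((a * X ω + b * Y ω : ℝ) : ℂ) * Complex.I) ∂μ).re =
      ∫ ω, Real.cos (a * X ω + b * Y ω) ∂μ := by
    rw [← RCLike.re_eq_complex_re, ← integral_re hint]
    simp only [RCLike.re_eq_complex_re, Complex.exp_ofReal_mul_I_re]
  rw [← hre]
  have hmap := integral_map (μ := μ) hmeas.aemeasurable
    (f := fun x : ℝ => Complex.exp ((x : ℂ) * Complex.I)) (by fun_prop)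
  rw [← hmap]
  refine Eq.trans ?_ (hchar.trans ?_)
  · simp only [Complex.ofReal_one, one_mul]
    rfl
  · rw [← Complex.exp_ofReal_re]
    congr 2
    simp
    ring

/-- Covariance of the centered summands of the realized joint Laplace transform
estimator, for independent standard Gaussians `G₁, G₂` and `u, v, u', v' ≥ 0`. -/
theorem covariance_centered_summands
    {Ω : Type*} [MeasurableSpace Ω] (μ : Measure Ω) [IsProbabilityMeasure μ]
    (G₁ G₂ : Ω → ℝ) (hmG₁ : Measurable G₁) (hmG₂ : Measurable G₂)
    (h₁ : μ.map G₁ = gaussianReal 0 1) (h₂ : μ.map G₂ = gaussianReal 0 1)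
    (hind : IndepFun G₁ G₂ μ)
    (u v u' v' σx σy : ℝ) (hu : 0 ≤ u) (hv : 0 ≤ v) (hu' : 0 ≤ u') (hv' : 0 ≤ v') :
    ∫ ω,
        (Real.cos (Real.sqrt (2 * u) * σx * G₁ ω + Real.sqrt (2 * v) * σy * G₂ ω)
          - Real.exp (-(u * σx ^ 2) - v * σy ^ 2)) *
        (Real.cos (Real.sqrt (2 * u') * σx * G₁ ω + Real.sqrt (2 * v') * σy * G₂ ω)
          - Real.exp (-(u' * σx ^ 2) - v' * σy ^ 2)) ∂μ
      = (1 / 2) * Real.exp (-((Real.sqrt u + Real.sqrt u') ^ 2 * σx ^ 2)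
            - (Real.sqrt v + Real.sqrt v') ^ 2 * σy ^ 2)
        + (1 / 2) * Real.exp (-((Real.sqrt u - Real.sqrt u') ^ 2 * σx ^ 2)
            - (Real.sqrt v - Real.sqrt v') ^ 2 * σy ^ 2)
        - Real.exp (-((u + u') * σx ^ 2) - (v + v') * σy ^ 2) := by
  have hcos (a b : ℝ) :=
    integral_cos_linear_of_indepFun_gaussianReal hmG₁ hmG₂ h₁ h₂ hind a b
  have hint (a b : ℝ) : Integrable (fun ω => Real.cos (a * G₁ ω + b * G₂ ω)) μ :=
    Integrable.of_bound (by fun_prop) 1 (ae_of_all _ fun ω => Real.abs_cos_le_one _)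
  have hmean (s t : ℝ) (hs : 0 ≤ s) (ht : 0 ≤ t) :
      ∫ ω, Real.cos (√(2 * s) * σx * G₁ ω + √(2 * t) * σy * G₂ ω) ∂μ =
        Real.exp (-(s * σx ^ 2) - t * σy ^ 2) := by
    rw [hcos, mul_pow, mul_pow, Real.sq_sqrt (by positivity), Real.sq_sqrt (by positivity)]
    ring_nf
  have hplus := hcos ((√(2 * u) + √(2 * u')) * σx) ((√(2 * v) + √(2 * v')) * σy)
  have hminus := hcos ((√(2 * u) - √(2 * u')) * σx) ((√(2 * v) - √(2 * v')) * σy)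
  have hprod (ω : Ω) :
      (Real.cos (√(2 * u) * σx * G₁ ω + √(2 * v) * σy * G₂ ω)
          - Real.exp (-(u * σx ^ 2) - v * σy ^ 2)) *
        (Real.cos (√(2 * u') * σx * G₁ ω + √(2 * v') * σy * G₂ ω)
          - Real.exp (-(u' * σx ^ 2) - v' * σy ^ 2)) =
      (1 / 2) * Real.cos ((√(2 * u) + √(2 * u')) * σx * G₁ ω
            + (√(2 * v) + √(2 * v')) * σy * G₂ ω)
        + (1 / 2) * Real.cos ((√(2 * u) - √(2 * u')) * σx * G₁ ω
            + (√(2 * v) - √(2 * v')) * σy * G₂ ω)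
        - Real.exp (-(u' * σx ^ 2) - v' * σy ^ 2)
            * Real.cos (√(2 * u) * σx * G₁ ω + √(2 * v) * σy * G₂ ω)
        - Real.exp (-(u * σx ^ 2) - v * σy ^ 2)
            * Real.cos (√(2 * u') * σx * G₁ ω + √(2 * v') * σy * G₂ ω)
        + Real.exp (-(u * σx ^ 2) - v * σy ^ 2) * Real.exp (-(u' * σx ^ 2) - v' * σy ^ 2) := by
    have hadd := Real.cos_add (√(2 * u) * σx * G₁ ω + √(2 * v) * σy * G₂ ω)
      (√(2 * u') * σx * G₁ ω + √(2 * v') * σy * G₂ ω)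
    have hsub := Real.cos_sub (√(2 * u) * σx * G₁ ω + √(2 * v) * σy * G₂ ω)
      (√(2 * u') * σx * G₁ ω + √(2 * v') * σy * G₂ ω)
    rw [show (√(2 * u) + √(2 * u')) * σx * G₁ ω + (√(2 * v) + √(2 * v')) * σy * G₂ ω =
        (√(2 * u) * σx * G₁ ω + √(2 * v) * σy * G₂ ω)
          + (√(2 * u') * σx * G₁ ω + √(2 * v') * σy * G₂ ω) by ring,
      show (√(2 * u) - √(2 * u')) * σx * G₁ ω + (√(2 * v) - √(2 * v')) * σy * G₂ ω =
        (√(2 * u) * σx * G₁ ω + √(2 * v) * σy * G₂ ω)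
          - (√(2 * u') * σx * G₁ ω + √(2 * v') * σy * G₂ ω) by ring, hadd, hsub]
    ring
  simp_rw [hprod]
  rw [integral_add (by fun_prop) (by fun_prop), integral_sub (by fun_prop) (by fun_prop),
    integral_sub (by fun_prop) (by fun_prop), integral_add (by fun_prop) (by fun_prop)]
  simp only [integral_const_mul, integral_const, probReal_univ, smul_eq_mul, one_mul]
  rw [hplus, hminus, hmean u v hu hv, hmean u' v' hu' hv']
  have h2 : √2 ^ 2 = (2 : ℝ) := Real.sq_sqrt (by norm_num)
  have hexp : Real.exp (-((u + u') * σx ^ 2) - (v + v') * σy ^ 2) =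
      Real.exp (-(u * σx ^ 2) - v * σy ^ 2) * Real.exp (-(u' * σx ^ 2) - v' * σy ^ 2) := by
    rw [← Real.exp_add]
    ring_nf
  have hplus_exponent :
      -(((√(2 * u) + √(2 * u')) * σx) ^ 2 + ((√(2 * v) + √(2 * v')) * σy) ^ 2) / 2 =
        -((√u + √u') ^ 2 * σx ^ 2) - (√v + √v') ^ 2 * σy ^ 2 := by
    simp only [Real.sqrt_mul zero_le_two]
    linear_combination (-((√u + √u') ^ 2 * σx ^ 2) - (√v + √v') ^ 2 * σy ^ 2) / 2 * h2
  have hminus_exponent :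
      -(((√(2 * u) - √(2 * u')) * σx) ^ 2 + ((√(2 * v) - √(2 * v')) * σy) ^ 2) / 2 =
        -((√u - √u') ^ 2 * σx ^ 2) - (√v - √v') ^ 2 * σy ^ 2 := by
    simp only [Real.sqrt_mul zero_le_two]
    linear_combination (-((√u - √u') ^ 2 * σx ^ 2) - (√v - √v') ^ 2 * σy ^ 2) / 2 * h2
  rw [hexp, hplus_exponent, hminus_exponent]
  ring
end

section
/- For all real numbers u ≥ 0, v ≥ 0, σx, σy, and ρ ∈ [−1, 1], writing c = u·σx² + v·σy², one has e^{−2c}·(e^{−2c} + e^{2c} − 2) ≥ (1/2)·e^{−2c}·(e^{−2c} + e^{2c} + 2·e^{−2√(uv)·σx·σy·ρ} + 2·e^{2√(uv)·σx·σy·ρ} − 6). -/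
/-- The weighted arithmetic–geometric mean inequality with a correlation factor `|ρ| ≤ 1`. -/
lemma abs_two_mul_sqrt_mul_le {u v ρ : ℝ} (a b : ℝ) (hu : 0 ≤ u) (hv : 0 ≤ v) (hρ : |ρ| ≤ 1) :
    |2 * Real.sqrt (u * v) * a * b * ρ| ≤ u * a ^ 2 + v * b ^ 2 := by
  have amgm : |2 * Real.sqrt (u * v) * a * b| ≤ u * a ^ 2 + v * b ^ 2 := by
    have h₁ := Real.sq_sqrt hu
    have h₂ := Real.sq_sqrt hv
    rw [Real.sqrt_mul hu, abs_le]
    constructor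
    · nlinarith [sq_nonneg (Real.sqrt u * a + Real.sqrt v * b)]
    · nlinarith [sq_nonneg (Real.sqrt u * a - Real.sqrt v * b)]
  rw [abs_mul]
  exact (mul_le_of_le_one_right (abs_nonneg _) hρ).trans amgm

lemma two_mul_cosh_le_cosh_two_mul_add_one {t c : ℝ} (h : |t| ≤ c) :
    2 * Real.cosh t ≤ Real.cosh (2 * c) + 1 := by
  have htc : Real.cosh t ≤ Real.cosh c := Real.cosh_le_cosh.2 (h.trans (le_abs_self c))
  have hc := Real.one_le_cosh c
  rw [Real.cosh_two_mul, Real.sinh_sq]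
  nlinarith

/-- The asymptotic variance kernel of the overlapped estimator `Uₙ` is no larger
than that of the non-overlapped estimator `Vₙ`: with `c = uσx² + vσy²`,
`e^{−2c}(e^{−2c} + e^{2c} − 2)
  ≥ (1/2)e^{−2c}(e^{−2c} + e^{2c} + 2e^{−2√(uv)σxσyρ} + 2e^{2√(uv)σxσyρ} − 6)`. -/
theorem variance_kernel_comparison (u v σx σy ρ : ℝ)
    (hu : 0 ≤ u) (hv : 0 ≤ v) (hρ : ρ ∈ Set.Icc (-1 : ℝ) 1) :
    (1 / 2) * Real.exp (-(2 * (u * σx ^ 2 + v * σy ^ 2))) *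
        (Real.exp (-(2 * (u * σx ^ 2 + v * σy ^ 2)))
          + Real.exp (2 * (u * σx ^ 2 + v * σy ^ 2))
          + 2 * Real.exp (-(2 * Real.sqrt (u * v) * σx * σy * ρ))
          + 2 * Real.exp (2 * Real.sqrt (u * v) * σx * σy * ρ) - 6)
      ≤ Real.exp (-(2 * (u * σx ^ 2 + v * σy ^ 2))) *
          (Real.exp (-(2 * (u * σx ^ 2 + v * σy ^ 2)))
            + Real.exp (2 * (u * σx ^ 2 + v * σy ^ 2)) - 2) := by
  have key := two_mul_cosh_le_cosh_two_mul_add_one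
    (abs_two_mul_sqrt_mul_le σx σy hu hv (abs_le.2 hρ))
  rw [Real.cosh_eq, Real.cosh_eq] at key
  rw [mul_comm (1 / 2 : ℝ), mul_assoc]
  gcongr
  linarith
end
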